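/- arXiv:1708.07671 — 7 statements merged into one kernel-verified Lean document; each statement's English description precedes it below -/
import Mathlib

section
/- Let m : ℕ → ℕ and set ζ(n) := (2·m(n) − 2n)·n^{−3/5}. Suppose ζ(n) → ∞ and ζ(n)·(log n)^{2/3}/n^{2/5} → 0 as n → ∞. If l₀ : ℕ → ℝ is such that for every sufficiently large n, l₀(n) solves the excess equation for (n, m(n)), then there exist constants c₁, c₂ > 0 such that for all sufficiently large n: c₁·ζ(n)^{−3/2}·n^{3/5} ≤ l₀(n) − ζ(n)·n^{3/5}/2 ≤ c₂·ζ(n)^{−3/2}·n^{3/5}. -/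
open Filter

/-- The constant γ = 79^(3/4)/54^(1/2). -/
noncomputable def gammaK : ℝ := (79 : ℝ) ^ ((3 : ℝ) / 4) / (54 : ℝ) ^ ((1 : ℝ) / 2)

/-- The constant φ = 2·√e·γ²·3^(−3/2). -/
noncomputable def phiC : ℝ := 2 * Real.sqrt (Real.exp 1) * gammaK ^ 2 * (3 : ℝ) ^ (-(3 : ℝ) / 2)

/-- `l₀` solves the excess equation for `(n, m)`: it lies strictly between
`max 0 (m − n)` and `m − n/2` and satisfies
`l₀ · e^(1/3) · 2^(4/3) · (n − m + l₀)^(2/3) = φ^(2/3) · (2m − n − 2l₀)`. -/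
def SolvesExcessEq (n m l₀ : ℝ) : Prop :=
  max 0 (m - n) < l₀ ∧ l₀ < m - n / 2 ∧
    l₀ * Real.exp 1 ^ ((1 : ℝ) / 3) * (2 : ℝ) ^ ((4 : ℝ) / 3) * (n - m + l₀) ^ ((2 : ℝ) / 3)
      = phiC ^ ((2 : ℝ) / 3) * (2 * m - n - 2 * l₀)



lemma aux_pow (c z N : ℝ) (hc : 0 < c) (hz : 0 < z) (hN : 0 < N) :
    (c * (z⁻¹ * N ^ ((2:ℝ)/5))) ^ ((3:ℝ)/2)
      = c ^ ((3:ℝ)/2) * z ^ (-(3:ℝ)/2) * N ^ ((3:ℝ)/5) := by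
  have hNp : 0 < N ^ ((2:ℝ)/5) := Real.rpow_pos_of_pos hN _
  have hzi : 0 < z⁻¹ := inv_pos.mpr hz
  rw [Real.mul_rpow hc.le (by positivity), Real.mul_rpow hzi.le hNp.le, ← Real.rpow_mul hN.le,
    ← Real.rpow_neg_one z, ← Real.rpow_mul hz.le]
  norm_num [mul_assoc]

lemma aux_det (K z N P d : ℝ) (hK : 0 < K) (hz : 1 ≤ z) (hN : 1 ≤ N) (hP : P = N ^ ((3:ℝ)/5))
    (hd : 0 < d) (hs : (2 * K) ^ ((3:ℝ)/2) * z ^ (-(3:ℝ)/2) ≤ 1/4)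
    (he : (z * P / 2 + d) * d ^ ((2:ℝ)/3) = K * (N - 2 * d)) :
    (K / 2) ^ ((3:ℝ)/2) * z ^ (-(3:ℝ)/2) * P ≤ d ∧
      d ≤ (2 * K) ^ ((3:ℝ)/2) * z ^ (-(3:ℝ)/2) * P := by
  have hN0 : 0 < N := by linarith
  have hz0 : 0 < z := by linarith
  have hP0 : 0 < P := hP ▸ Real.rpow_pos_of_pos hN0 _
  have hPN : P ≤ N := by
    rw [hP]
    calc N ^ ((3:ℝ)/5) ≤ N ^ (1:ℝ) := Real.rpow_le_rpow_of_exponent_le hN (by norm_num)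
      _ = N := Real.rpow_one N
  set Q := N ^ ((2:ℝ)/5) with hQ
  have hQ0 : 0 < Q := Real.rpow_pos_of_pos hN0 _
  have hPQ : N = P * Q := by
    rw [hP, hQ, ← Real.rpow_add hN0]; norm_num
  set y := d ^ ((2:ℝ)/3) with hy
  have hy0 : 0 < y := Real.rpow_pos_of_pos hd _
  have hyd : y ^ ((3:ℝ)/2) = d := by
    rw [hy, ← Real.rpow_mul hd.le]; norm_num
  have hup : d ≤ (2 * K) ^ ((3:ℝ)/2) * z ^ (-(3:ℝ)/2) * P := by
    rw [hP, ← aux_pow _ _ _ (by positivity) hz0 hN0, ← hyd]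
    apply Real.rpow_le_rpow hy0.le _ (by norm_num)
    rw [← hQ]
    have h1 : z * P * y ≤ 2 * K * (P * Q) := by
      rw [← hPQ]; nlinarith [mul_pos hd hy0, mul_pos hK hd]
    have h2 : z * y ≤ 2 * K * Q := by
      by_contra h
      push Not at h
      nlinarith
    calc y = z⁻¹ * (z * y) := by field_simp
      _ ≤ z⁻¹ * (2 * K * Q) := by gcongr
      _ = _ := by ring
  refine ⟨?_, hup⟩
  have hd4 : d ≤ 1/4 * P := hup.trans (by gcongr)
  rw [hP, ← aux_pow _ _ _ (by positivity) hz0 hN0, ← hyd]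
  apply Real.rpow_le_rpow (by positivity) _ (by norm_num)
  rw [← hQ]
  have hda : d ≤ z * P / 2 := by nlinarith
  have h1 : K / 2 * (P * Q) ≤ z * P * y := by
    rw [← hPQ]
    have e1 : (z * P / 2 + d) * y ≤ z * P * y := by
      apply mul_le_mul_of_nonneg_right _ hy0.le
      linarith
    have e2 : K * (N / 2) ≤ K * (N - 2 * d) := by
      apply mul_le_mul_of_nonneg_left _ hK.le
      linarith
    linarith
  have h2 : K / 2 * Q ≤ z * y := by
    by_contra h
    push Not at h
    nlinarith
  calc K / 2 * (z⁻¹ * Q) = z⁻¹ * (K / 2 * Q) := by ring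
    _ ≤ z⁻¹ * (z * y) := by gcongr
    _ = y := by field_simp

lemma phiC_pos : 0 < phiC := by
  unfold phiC gammaK
  positivity

theorem stmt9 (m : ℕ → ℕ) (l₀ : ℕ → ℝ)
    (hzeta : Tendsto (fun n : ℕ => ((2 * m n : ℝ) - 2 * n) * (n : ℝ) ^ (-(3 : ℝ) / 5)) atTop atTop)
    (hzeta' : Tendsto
      (fun n : ℕ => (((2 * m n : ℝ) - 2 * n) * (n : ℝ) ^ (-(3 : ℝ) / 5))
        * Real.log n ^ ((2 : ℝ) / 3) / (n : ℝ) ^ ((2 : ℝ) / 5))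
      atTop (nhds 0))
    (hl : ∀ᶠ n : ℕ in atTop, SolvesExcessEq n (m n) (l₀ n)) :
    ∃ c₁ c₂ : ℝ, 0 < c₁ ∧ 0 < c₂ ∧ ∀ᶠ n : ℕ in atTop,
      c₁ * (((2 * m n : ℝ) - 2 * n) * (n : ℝ) ^ (-(3 : ℝ) / 5)) ^ (-(3 : ℝ) / 2)
          * (n : ℝ) ^ ((3 : ℝ) / 5) ≤
        l₀ n - (((2 * m n : ℝ) - 2 * n) * (n : ℝ) ^ (-(3 : ℝ) / 5)) * (n : ℝ) ^ ((3 : ℝ) / 5) / 2 ∧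
      l₀ n - (((2 * m n : ℝ) - 2 * n) * (n : ℝ) ^ (-(3 : ℝ) / 5)) * (n : ℝ) ^ ((3 : ℝ) / 5) / 2 ≤
        c₂ * (((2 * m n : ℝ) - 2 * n) * (n : ℝ) ^ (-(3 : ℝ) / 5)) ^ (-(3 : ℝ) / 2)
          * (n : ℝ) ^ ((3 : ℝ) / 5) := by
  set A : ℝ := Real.exp 1 ^ ((1 : ℝ) / 3) * (2 : ℝ) ^ ((4 : ℝ) / 3) with hA
  have hA0 : 0 < A := by positivity
  have hB0 : 0 < phiC ^ ((2 : ℝ) / 3) := Real.rpow_pos_of_pos phiC_pos _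
  set B : ℝ := phiC ^ ((2 : ℝ) / 3) with hB
  have hK : 0 < B / A := by positivity
  refine ⟨(B / A / 2) ^ ((3:ℝ)/2), (2 * (B / A)) ^ ((3:ℝ)/2), by positivity, by positivity, ?_⟩
  have hlim := ((tendsto_rpow_neg_atTop (y := (3:ℝ)/2) (by norm_num)).comp hzeta).const_mul
    ((2 * (B / A)) ^ ((3:ℝ)/2))
  rw [mul_zero] at hlim
  have hs := hlim.eventually (eventually_le_nhds (show (0:ℝ) < 1/4 by norm_num))
  filter_upwards [hl, hs, hzeta.eventually_ge_atTop 1, eventually_ge_atTop 1] with n h1 h2 h3 h4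
  obtain ⟨g1, g2, g3⟩ := h1
  have hn1 : (1:ℝ) ≤ n := by exact_mod_cast h4
  have hn0 : (0:ℝ) < n := by linarith
  have hzP : (((2 * m n : ℝ) - 2 * n) * (n : ℝ) ^ (-(3 : ℝ) / 5)) * (n : ℝ) ^ ((3 : ℝ) / 5) / 2
      = m n - n := by
    rw [mul_assoc, ← Real.rpow_add hn0]
    norm_num
    ring
  have hd : 0 < l₀ n - ((m n : ℝ) - n) := by
    have := (le_max_right 0 ((m n : ℝ) - n)).trans_lt g1
    linarith
  simp only [Function.comp, ← neg_div] at h2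
  have key := aux_det (B / A) _ n _ (l₀ n - ((m n : ℝ) - n)) hK h3 hn1 rfl hd h2 (by
    rw [hzP, div_mul_eq_mul_div, eq_div_iff hA0.ne']
    have e1 : (n:ℝ) - m n + l₀ n = l₀ n - (m n - n) := by ring
    rw [e1] at g3
    rw [hA]
    linear_combination g3)
  rw [hzP]
  exact key
end

section
/- Let l, d ∈ ℕ with 3d ≤ l, let V be a finite vertex set with |V| = 2l, and let G be a simple graph on V in which every vertex has degree exactly 3. Then the number of matchings of size d in G (i.e., d-element sets of pairwise disjoint edges of G) is at least (∏_{j=0}^{d−1} (2l − 6j)) / (2^d · d!). -/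
open Finset in
/-- The finset of matchings of size `d`. -/
noncomputable def matchF {V : Type} [Fintype V] [DecidableEq V] (G : SimpleGraph V)
    [DecidableRel G.Adj] (d : ℕ) : Finset (Finset (Sym2 V)) :=
  by
    classical
    exact G.edgeFinset.powerset.filter (fun s => s.card = d ∧
      (s : Set (Sym2 V)).Pairwise fun e f => ∀ v : V, v ∈ e → v ∉ f)

lemma mem_matchF {V : Type} [Fintype V] [DecidableEq V] (G : SimpleGraph V)
    [DecidableRel G.Adj] (d : ℕ) (s : Finset (Sym2 V)) : s ∈ matchF G d ↔
      s ⊆ G.edgeFinset ∧ s.card = d ∧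
      (s : Set (Sym2 V)).Pairwise fun e f => ∀ v : V, v ∈ e → v ∉ f := by
  simp only [matchF, Finset.mem_filter, Finset.mem_powerset]

lemma touch_card {V : Type} [Fintype V] [DecidableEq V] (G : SimpleGraph V)
    [DecidableRel G.Adj] (hdeg : ∀ v : V, G.degree v = 3) (f : Sym2 V) :
    (G.edgeFinset.filter (fun e => ∃ v, v ∈ e ∧ v ∈ f)).card ≤ 6 := by
  induction f using Sym2.ind with
  | _ a b =>
  calc _ ≤ (G.incidenceFinset a ∪ G.incidenceFinset b).card := by
        apply Finset.card_le_card
        intro e he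
        simp only [Finset.mem_filter, Sym2.mem_iff, SimpleGraph.mem_edgeFinset] at he
        obtain ⟨he, v, hv, rfl | rfl⟩ := he
        · exact Finset.mem_union_left _ (by
            rw [SimpleGraph.mem_incidenceFinset]; exact ⟨he, hv⟩)
        · exact Finset.mem_union_right _ (by
            rw [SimpleGraph.mem_incidenceFinset]; exact ⟨he, hv⟩)
    _ ≤ _ := Finset.card_union_le _ _
    _ = 6 := by simp [hdeg]

lemma matchF_step {V : Type} [Fintype V] [DecidableEq V] (G : SimpleGraph V)
    [DecidableRel G.Adj] (hdeg : ∀ v : V, G.degree v = 3) (l d : ℕ)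
    (hV : Fintype.card V = 2 * l) :
    (matchF G d).card * (3 * l - 6 * d) ≤ (matchF G (d + 1)).card * (d + 1) := by
  classical
  have hE : G.edgeFinset.card = 3 * l := by
    have h := G.sum_degrees_eq_twice_card_edges
    simp only [hdeg, Finset.sum_const, Finset.card_univ, hV, smul_eq_mul] at h
    omega
  apply Finset.card_mul_le_card_mul (fun a b => a ⊆ b)
  · intro s hs
    rw [mem_matchF] at hs
    obtain ⟨hsE, hsc, hsp⟩ := hs
    set bad := s.biUnion (fun f => G.edgeFinset.filter (fun e => ∃ v, v ∈ e ∧ v ∈ f)) with hbad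
    have hb : bad.card ≤ d * 6 := by
      rw [← hsc]
      exact Finset.card_biUnion_le_card_mul _ _ _ (fun f _ => touch_card G hdeg f)
    have hgood : 3 * l - 6 * d ≤ (G.edgeFinset \ bad).card := by
      have := Finset.le_card_sdiff bad G.edgeFinset
      omega
    have hdisj : ∀ e ∈ G.edgeFinset \ bad, ∀ f ∈ s, ∀ v, v ∈ e → v ∉ f := by
      intro e he f hf v hve hvf
      rw [Finset.mem_sdiff] at he
      exact he.2 (Finset.mem_biUnion.2 ⟨f, hf, Finset.mem_filter.2 ⟨he.1, v, hve, hvf⟩⟩)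
    have hnot : ∀ e ∈ G.edgeFinset \ bad, e ∉ s := by
      intro e he hes
      induction e using Sym2.ind with
      | _ a b => exact hdisj _ he _ hes a (Sym2.mem_mk_left a b) (Sym2.mem_mk_left a b)
    refine hgood.trans (Finset.card_le_card_of_injOn (fun e => insert e s) ?_ ?_)
    · intro e he
      have he : e ∈ G.edgeFinset \ bad := he
      simp only [Finset.mem_coe, Finset.mem_bipartiteAbove, mem_matchF]
      refine ⟨⟨?_, ?_, ?_⟩, Finset.subset_insert _ _⟩
      · exact Finset.insert_subset (Finset.mem_sdiff.1 he).1 hsE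
      · rw [Finset.card_insert_of_notMem (hnot e he), hsc]
      · rw [Finset.coe_insert]
        refine hsp.insert ?_
        intro f hf _
        exact ⟨hdisj e he f hf, fun v hv hv' => hdisj e he f hf v hv' hv⟩
    · intro e he e' he' h
      have h : insert e s = insert e' s := h
      have h1 : e ∈ insert e' s := h ▸ Finset.mem_insert_self e s
      rcases Finset.mem_insert.1 h1 with h2 | h2
      · exact h2
      · exact absurd h2 (hnot e he)
  · intro t ht
    rw [mem_matchF] at ht
    calc _ ≤ (t.powersetCard d).card := by
          apply Finset.card_le_card
          intro s hs
          rw [Finset.mem_bipartiteBelow, mem_matchF] at hs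
          exact Finset.mem_powersetCard.2 ⟨hs.2, hs.1.2.1⟩
      _ = d + 1 := by rw [Finset.card_powersetCard, ht.2.1, Nat.choose_succ_self_right]

theorem stmt10 (l d : ℕ) (hd : 3 * d ≤ l) (V : Type) [Fintype V] [DecidableEq V]
    (hV : Fintype.card V = 2 * l) (G : SimpleGraph V) [DecidableRel G.Adj]
    (hdeg : ∀ v : V, G.degree v = 3) :
    (∏ j ∈ Finset.range d, ((2 * l : ℝ) - 6 * j)) / (2 ^ d * (Nat.factorial d : ℝ)) ≤
      (Nat.card {s : Finset (Sym2 V) // s ⊆ G.edgeFinset ∧ s.card = d ∧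
        (s : Set (Sym2 V)).Pairwise fun e f => ∀ v : V, v ∈ e → v ∉ f} : ℝ) := by
  have hc : Nat.card {s : Finset (Sym2 V) // s ⊆ G.edgeFinset ∧ s.card = d ∧
        (s : Set (Sym2 V)).Pairwise fun e f => ∀ v : V, v ∈ e → v ∉ f} = (matchF G d).card := by
    rw [← Nat.card_eq_finsetCard]
    exact Nat.card_congr (Equiv.subtypeEquivRight (fun s => (mem_matchF G d s).symm))
  rw [hc]
  clear hc
  induction d with
  | zero =>
    have : (∅ : Finset (Sym2 V)) ∈ matchF G 0 := by simp [mem_matchF]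
    have h : 1 ≤ (matchF G 0).card := Finset.card_pos.2 ⟨_, this⟩
    simpa using h
  | succ d ih =>
    have ih := ih (by omega)
    have hs := matchF_step G hdeg l d hV
    have hs' : ((matchF G d).card : ℝ) * (l - 3 * d) ≤ (matchF G (d + 1)).card * (d + 1) := by
      have h1 : (matchF G d).card * (l - 3 * d) ≤ (matchF G (d + 1)).card * (d + 1) :=
        (Nat.mul_le_mul_left _ (by omega)).trans hs
      have h2 : ((l - 3 * d : ℕ) : ℝ) = l - 3 * d := by
        rw [Nat.cast_sub (by omega)]; push_cast; ring
      rw [← h2]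
      exact_mod_cast h1
    have hl : (0 : ℝ) ≤ l - 3 * d := by
      have : ((3 * d : ℕ) : ℝ) ≤ l := by exact_mod_cast (by omega : 3 * d ≤ l)
      push_cast at this
      linarith
    have hd1 : (0 : ℝ) < d + 1 := by positivity
    have key : (∏ j ∈ Finset.range (d + 1), ((2 * l : ℝ) - 6 * j)) /
        (2 ^ (d + 1) * (Nat.factorial (d + 1) : ℝ)) =
        ((∏ j ∈ Finset.range d, ((2 * l : ℝ) - 6 * j)) / (2 ^ d * (Nat.factorial d : ℝ)))
          * (l - 3 * d) / (d + 1) := by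
      rw [Finset.prod_range_succ, Nat.factorial_succ]
      have : (Nat.factorial d : ℝ) ≠ 0 := by positivity
      push_cast
      field_simp
      ring
    rw [key, div_le_iff₀ hd1]
    exact (mul_le_mul_of_nonneg_right ih hl).trans hs'
end

section
/- For all natural numbers k and i with 1 ≤ i < k, the falling factorial (k)_i = k!/(k−i)! satisfies k^i · exp(−i²/(2(k−i))) ≤ k!/(k−i)! ≤ k^i · exp(−i(i−1)/(2k)). -/
theorem aux_upper (k n : ℕ) (h : n < k) :
    (k.descFactorial n : ℝ) ≤ (k : ℝ) ^ n * Real.exp (-((n : ℝ) * ((n : ℝ) - 1)) / (2 * k)) := by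
  induction n with
  | zero => simp
  | succ n ih =>
    have ih := ih (by omega)
    have hk : (0 : ℝ) < k := by exact_mod_cast (by omega : 0 < k)
    have hn : (n : ℝ) ≤ k := by exact_mod_cast (by omega : n ≤ k)
    have e : (k : ℝ) - n ≤ k * Real.exp (-(n : ℝ) / k) := by
      have := Real.add_one_le_exp (-(n : ℝ) / k)
      calc (k : ℝ) - n = k * (-(n : ℝ) / k + 1) := by field_simp; ring
        _ ≤ _ := by gcongr
    rw [Nat.descFactorial_succ, Nat.cast_mul, Nat.cast_sub (by omega)]
    calc ((k : ℝ) - n) * (k.descFactorial n : ℝ)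
        ≤ (k * Real.exp (-(n : ℝ) / k)) *
          ((k : ℝ) ^ n * Real.exp (-((n : ℝ) * ((n : ℝ) - 1)) / (2 * k))) := by
          apply mul_le_mul e ih (by positivity) (by positivity)
      _ = (k : ℝ) ^ (n + 1) *
          (Real.exp (-(n : ℝ) / k) * Real.exp (-((n : ℝ) * ((n : ℝ) - 1)) / (2 * k))) := by ring
      _ = _ := by
          rw [← Real.exp_add]
          congr 2
          push_cast
          field_simp
          ring

theorem aux_lower (k i n : ℕ) (h : i < k) (hni : n ≤ i) :
    (k : ℝ) ^ n * Real.exp (-((n : ℝ) * ((n : ℝ) - 1)) / (2 * ((k : ℝ) - i))) ≤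
      (k.descFactorial n : ℝ) := by
  induction n with
  | zero => simp
  | succ n ih =>
    have ih := ih (by omega)
    have hn : (n : ℝ) ≤ i := by exact_mod_cast (by omega : n ≤ i)
    have hD : (0 : ℝ) < (k : ℝ) - i := sub_pos.2 (by exact_mod_cast h)
    have hkn : (0 : ℝ) < (k : ℝ) - n := by linarith
    have e : (k : ℝ) * Real.exp (-(n : ℝ) / ((k : ℝ) - i)) ≤ k - n := by
      have h1 := Real.add_one_le_exp ((n : ℝ) / ((k : ℝ) - i))
      have h2 : (n : ℝ) / ((k : ℝ) - n) ≤ (n : ℝ) / ((k : ℝ) - i) := by gcongr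
      have h3 : (k : ℝ) = (k - n) * ((n : ℝ) / ((k : ℝ) - n) + 1) := by field_simp; ring
      rw [neg_div, Real.exp_neg, ← div_eq_mul_inv, div_le_iff₀ (Real.exp_pos _)]
      calc (k : ℝ) = (k - n) * ((n : ℝ) / ((k : ℝ) - n) + 1) := h3
        _ ≤ _ := by
          apply mul_le_mul_of_nonneg_left _ hkn.le
          linarith
    rw [Nat.descFactorial_succ, Nat.cast_mul, Nat.cast_sub (by omega)]
    calc _ = (k : ℝ) ^ (n + 1) * (Real.exp (-(n : ℝ) / ((k : ℝ) - i)) *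
            Real.exp (-((n : ℝ) * ((n : ℝ) - 1)) / (2 * ((k : ℝ) - i)))) := by
          rw [← Real.exp_add]
          congr 2
          push_cast
          field_simp
          ring
      _ = (k * Real.exp (-(n : ℝ) / ((k : ℝ) - i))) *
          ((k : ℝ) ^ n * Real.exp (-((n : ℝ) * ((n : ℝ) - 1)) / (2 * ((k : ℝ) - i)))) := by ring
      _ ≤ _ := mul_le_mul e ih (by positivity) hkn.le

theorem stmt11 (k i : ℕ) (h1 : 1 ≤ i) (h2 : i < k) :
    (k : ℝ) ^ i * Real.exp (-(i : ℝ) ^ 2 / (2 * ((k : ℝ) - i))) ≤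
        (Nat.factorial k : ℝ) / (Nat.factorial (k - i) : ℝ) ∧
      (Nat.factorial k : ℝ) / (Nat.factorial (k - i) : ℝ) ≤
        (k : ℝ) ^ i * Real.exp (-((i : ℝ) * ((i : ℝ) - 1)) / (2 * k)) := by
  have hf : (Nat.factorial k : ℝ) / (Nat.factorial (k - i) : ℝ) = (k.descFactorial i : ℝ) := by
    rw [div_eq_iff (by positivity), mul_comm]
    exact_mod_cast (Nat.factorial_mul_descFactorial h2.le).symm
  rw [hf]
  refine ⟨le_trans ?_ (aux_lower k i i h2 le_rfl), aux_upper k i h2⟩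
  have hD : (0 : ℝ) < (k : ℝ) - i := sub_pos.2 (by exact_mod_cast h2)
  have hi : (0 : ℝ) ≤ i := by positivity
  apply mul_le_mul_of_nonneg_left _ (by positivity)
  apply Real.exp_le_exp.2
  apply div_le_div_of_nonneg_right _ (by positivity)
  nlinarith
end

section
/- For all natural numbers a ≥ 1 and k with k ≥ 2a + 1, one has (k! · (k−a−1)!) / ((k−2a)! · (k+a−1)!) ≥ exp(−2a²/(k−2a)). -/
theorem stmt13_aux (m b : ℕ) (hm : 1 ≤ m) (j : ℕ) :
    (Nat.factorial m : ℝ) * (Nat.factorial (m + b + j) : ℝ) ≤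
      (Nat.factorial (m + j) : ℝ) * (Nat.factorial (m + b) : ℝ) *
        Real.exp (((b : ℝ) + 1) / m) ^ j := by
  induction j with
  | zero => simp
  | succ j ih =>
    have hm' : (0 : ℝ) < m := by exact_mod_cast hm
    have h1 : ((b : ℝ) + 1) / m + 1 ≤ Real.exp (((b : ℝ) + 1) / m) := Real.add_one_le_exp _
    have h2 : (m + b + j + 1 : ℝ) ≤ (m + j + 1) * Real.exp (((b : ℝ) + 1) / m) := by
      have h3 : ((b : ℝ) + 1) / m * m = b + 1 := by field_simp
      have h4 : 0 ≤ ((b : ℝ) + 1) / m := by positivity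
      have h5 : 0 ≤ ((b : ℝ) + 1) / m * (j + 1) := by positivity
      have h6 := mul_le_mul_of_nonneg_left h1 (by positivity : (0 : ℝ) ≤ m + j + 1)
      nlinarith
    have h7 := mul_le_mul ih h2 (by positivity) (by positivity)
    rw [← add_assoc, ← add_assoc, Nat.factorial_succ, Nat.factorial_succ, pow_succ]
    push_cast
    linarith

theorem stmt13 (a k : ℕ) (ha : 1 ≤ a) (hk : 2 * a + 1 ≤ k) :
    Real.exp (-(2 * (a : ℝ) ^ 2) / ((k : ℝ) - 2 * a)) ≤
      ((Nat.factorial k : ℝ) * (Nat.factorial (k - a - 1) : ℝ)) /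
        ((Nat.factorial (k - 2 * a) : ℝ) * (Nat.factorial (k + a - 1) : ℝ)) := by
  obtain ⟨b, rfl⟩ : ∃ b, a = b + 1 := ⟨a - 1, by omega⟩
  obtain ⟨m, rfl⟩ : ∃ m, k = m + 2 * (b + 1) := ⟨k - 2 * (b + 1), by omega⟩
  have hm : 1 ≤ m := by omega
  have h := stmt13_aux m b hm (2 * (b + 1))
  rw [show m + 2 * (b + 1) - (b + 1) - 1 = m + b by omega,
    show m + 2 * (b + 1) - 2 * (b + 1) = m by omega,
    show m + 2 * (b + 1) + (b + 1) - 1 = m + b + 2 * (b + 1) by omega]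
  rw [← Real.exp_nat_mul] at h
  have e : -(2 * ((b + 1 : ℕ) : ℝ) ^ 2) / (((m + 2 * (b + 1) : ℕ) : ℝ) - 2 * ((b + 1 : ℕ) : ℝ))
      = -(((2 * (b + 1) : ℕ) : ℝ) * (((b : ℝ) + 1) / m)) := by
    push_cast
    rw [add_sub_cancel_right]
    ring
  rw [e, Real.exp_neg, le_div_iff₀ (by positivity), inv_mul_le_iff₀ (Real.exp_pos _)]
  linarith
end

section
/- For every real M > 0 and every real r with 0 ≤ r < M: (2/e)^r · (2M − r)^{−r} · (M − r)^{−(M−r)} ≤ M^{−M} · exp(−r³/(24·M²)). -/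
lemma aux_deriv (x : ℝ) (h0 : 0 ≤ x) (h1 : x < 1) :
    -Real.log (1 - x/2) + x/(2-x) + Real.log (1-x) + x^2/8 ≤ 0 := by
  have hd : ∀ y ∈ Set.Ico (0:ℝ) 1, HasDerivAt
      (fun x : ℝ => -Real.log (1 - x/2) + x/(2-x) + Real.log (1-x) + x^2/8)
      (-((-(1/2))/(1-y/2)) + (1*(2-y) - y*(-1))/(2-y)^2 + (-1)/(1-y) + (2*y)/8) y := by
    intro y hy
    have a1 : 1 - y/2 ≠ 0 := by linarith [hy.2]
    have a2 : 2 - y ≠ 0 := by linarith [hy.2]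
    have a3 : 1 - y ≠ 0 := by linarith [hy.2]
    have b1 := (((hasDerivAt_id y).div_const 2).const_sub 1).log a1
    have b2 := (hasDerivAt_id y).div ((hasDerivAt_id y).const_sub 2) a2
    have b3 := ((hasDerivAt_id y).const_sub 1).log a3
    have b4 := ((hasDerivAt_id y).pow 2).div_const 8
    refine HasDerivAt.congr_deriv (((b1.neg.add b2).add b3).add b4) ?_
    simp
  have ha : AntitoneOn (fun x : ℝ => -Real.log (1 - x/2) + x/(2-x) + Real.log (1-x) + x^2/8)
      (Set.Ico (0:ℝ) 1) := by
    apply antitoneOn_of_deriv_nonpos (convex_Ico 0 1)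
    · exact fun y hy => (hd y hy).continuousAt.continuousWithinAt
    · exact fun y hy => (hd y (interior_subset hy)).differentiableAt.differentiableWithinAt
    · intro y hy
      have hy := interior_subset hy
      rw [(hd y hy).deriv]
      obtain ⟨h0, h1⟩ := hy
      have a2 : 0 < 2 - y := by linarith
      have a3 : 0 < 1 - y := by linarith
      have e : -((-(1/2))/(1-y/2)) + (1*(2-y) - y*(-1))/(2-y)^2 + (-1)/(1-y) + (2*y)/8
          = -(y * (4 - (2-y)^2*(1-y))) / (4 * ((2-y)^2*(1-y))) := by
        have : 1 - y/2 = (2-y)/2 := by ring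
        rw [this]
        field_simp
        ring
      rw [e]
      apply div_nonpos_of_nonpos_of_nonneg
      · have : (2-y)^2*(1-y) ≤ 4 * 1 := by
          apply mul_le_mul <;> nlinarith
        nlinarith
      · positivity
  have := ha (show (0:ℝ) ∈ Set.Ico (0:ℝ) 1 by simp) ⟨h0, h1⟩ h0
  simpa using this

lemma aux_main (x : ℝ) (h0 : 0 ≤ x) (h1 : x < 1) :
    -x - x * Real.log (1 - x/2) - (1-x) * Real.log (1-x) + x^3/24 ≤ 0 := by
  have hd : ∀ y ∈ Set.Ico (0:ℝ) 1, HasDerivAt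
      (fun x : ℝ => -x - x * Real.log (1 - x/2) - (1-x) * Real.log (1-x) + x^3/24)
      (-Real.log (1 - y/2) + y/(2-y) + Real.log (1-y) + y^2/8) y := by
    intro y hy
    have a1 : 1 - y/2 ≠ 0 := by linarith [hy.2]
    have a2 : 2 - y ≠ 0 := by linarith [hy.2]
    have a3 : 1 - y ≠ 0 := by linarith [hy.2]
    have b1 := (hasDerivAt_id y).mul ((((hasDerivAt_id y).div_const 2).const_sub 1).log a1)
    have b3 := ((hasDerivAt_id y).const_sub 1).mul (((hasDerivAt_id y).const_sub 1).log a3)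
    have b4 := ((hasDerivAt_id y).pow 3).div_const 24
    refine HasDerivAt.congr_deriv ((((hasDerivAt_id y).neg.sub b1).sub b3).add b4) ?_
    have : 1 - y/2 = (2-y)/2 := by ring
    simp only [id, this]
    field_simp
    ring
  have ha : AntitoneOn
      (fun x : ℝ => -x - x * Real.log (1 - x/2) - (1-x) * Real.log (1-x) + x^3/24)
      (Set.Ico (0:ℝ) 1) := by
    apply antitoneOn_of_deriv_nonpos (convex_Ico 0 1)
    · exact fun y hy => (hd y hy).continuousAt.continuousWithinAt
    · exact fun y hy => (hd y (interior_subset hy)).differentiableAt.differentiableWithinAt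
    · intro y hy
      have hy := interior_subset hy
      rw [(hd y hy).deriv]
      exact aux_deriv y hy.1 hy.2
  have := ha (show (0:ℝ) ∈ Set.Ico (0:ℝ) 1 by simp) ⟨h0, h1⟩ h0
  simpa using this

theorem stmt14 (M r : ℝ) (hM : 0 < M) (hr0 : 0 ≤ r) (hrM : r < M) :
    (2 / Real.exp 1) ^ r * (2 * M - r) ^ (-r) * (M - r) ^ (-(M - r)) ≤
      M ^ (-M) * Real.exp (-r ^ 3 / (24 * M ^ 2)) := by
  obtain ⟨x, rfl⟩ : ∃ x, r = M * x := ⟨r / M, by field_simp⟩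
  have h0 : 0 ≤ x := nonneg_of_mul_nonneg_right hr0 hM
  have h1 : x < 1 := by nlinarith
  have key := aux_main x h0 h1
  have p1 : 0 < 1 - x := by linarith
  have p2 : 0 < 1 - x/2 := by linarith
  have e1 : 2 * M - M * x = 2 * (M * (1 - x/2)) := by ring
  have e2 : M - M * x = M * (1 - x) := by ring
  rw [e1, e2, Real.rpow_def_of_pos (by positivity), Real.rpow_def_of_pos (by positivity),
    Real.rpow_def_of_pos (by positivity), Real.rpow_def_of_pos hM, ← Real.exp_add,
    ← Real.exp_add, ← Real.exp_add, Real.exp_le_exp,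
    Real.log_div (by norm_num) (Real.exp_ne_zero _), Real.log_exp,
    Real.log_mul (by norm_num) (by positivity), Real.log_mul hM.ne' p2.ne',
    Real.log_mul hM.ne' p1.ne']
  have e3 : -(M * x)^3 / (24 * M^2) = -(M * (x^3/24)) := by field_simp
  rw [e3]
  have := mul_nonpos_of_nonneg_of_nonpos hM.le key
  nlinarith
end

section
/- There exists a constant c ∈ (0, 1) such that for every real M > 0 and every real r with 0 ≤ r ≤ c·M: (2/e)^r · (2M − r)^{−r} · (M − r)^{−(M−r)} ≥ M^{−M} · exp(−r³/(12·M²)). -/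
theorem aux_log (x : ℝ) (h0 : 0 ≤ x) (h1 : x < 1) (n : ℕ) :
    ∑ i ∈ Finset.range n, x ^ (i + 1) / ((i : ℝ) + 1) ≤ -Real.log (1 - x) := by
  have h := Real.hasSum_pow_div_log_of_abs_lt_one (x := x) (by rw [abs_of_nonneg h0]; exact h1)
  exact sum_le_hasSum _ (fun i _ => by positivity) h

theorem stmt15 :
    ∃ c : ℝ, 0 < c ∧ c < 1 ∧ ∀ M r : ℝ, 0 < M → 0 ≤ r → r ≤ c * M →
      M ^ (-M) * Real.exp (-r ^ 3 / (12 * M ^ 2)) ≤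
        (2 / Real.exp 1) ^ r * (2 * M - r) ^ (-r) * (M - r) ^ (-(M - r)) := by
  refine ⟨1 / 8, by norm_num, by norm_num, ?_⟩
  intro M r hM hr hrM
  obtain ⟨x, rfl⟩ : ∃ x, r = M * x := ⟨r / M, by field_simp⟩
  have hx0 : 0 ≤ x := nonneg_of_mul_nonneg_right hr hM
  have hx1 : x ≤ 1 / 8 := by
    by_contra h
    push Not at h
    nlinarith
  have e1 : 2 * M - M * x = 2 * (M * (1 - x / 2)) := by ring
  have e2 : M - M * x = M * (1 - x) := by ring
  have p1 : 0 < 1 - x / 2 := by linarith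
  have p2 : 0 < 1 - x := by linarith
  have a1 := aux_log (x / 2) (by linarith) (by linarith) 2
  have a2 := aux_log x (by linarith) (by linarith) 3
  norm_num [Finset.sum_range_succ] at a1 a2
  rw [e1, e2, Real.rpow_def_of_pos hM, Real.rpow_def_of_pos (by positivity),
    Real.rpow_def_of_pos (by positivity), Real.rpow_def_of_pos (by positivity),
    ← Real.exp_add, ← Real.exp_add, ← Real.exp_add, Real.exp_le_exp,
    Real.log_div (by norm_num) (Real.exp_pos 1).ne', Real.log_exp,
    Real.log_mul (by norm_num) (by positivity), Real.log_mul hM.ne' p1.ne',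
    Real.log_mul hM.ne' p2.ne']
  have e3 : -(M * x) ^ 3 / (12 * M ^ 2) = -(M * (x ^ 3 / 12)) := by field_simp
  rw [e3]
  generalize Real.log (1 - x / 2) = A at *
  generalize Real.log (1 - x) = B at *
  have b1 := mul_le_mul_of_nonneg_left a1 hx0
  have b2 := mul_le_mul_of_nonneg_left a2 p2.le
  have b3 : 0 ≤ x ^ 3 * (1 / 8 - x) := mul_nonneg (by positivity) (by linarith)
  have key : 0 ≤ -x - x * A - (1 - x) * B + x ^ 3 / 12 := by nlinarith
  have := mul_nonneg hM.le key
  nlinarith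
end

section
/- There exists a constant C > 0 such that for every real M ≥ 2 and every real r with 0 ≤ r ≤ M − 1: ((2M − r)·(M − r))^{−1/2} ≤ C · M^{−1} · exp(r³/(216·M²)). -/
theorem stmt16 :
    ∃ C : ℝ, 0 < C ∧ ∀ M r : ℝ, 2 ≤ M → 0 ≤ r → r ≤ M - 1 →
      ((2 * M - r) * (M - r)) ^ (-(1 : ℝ) / 2) ≤
        C * M⁻¹ * Real.exp (r ^ 3 / (216 * M ^ 2)) := by
  refine ⟨1728, by norm_num, fun M r hM hr hrM => ?_⟩
  have hM0 : 0 < M := by linarith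
  have hP : 0 < (2 * M - r) * (M - r) := mul_pos (by linarith) (by linarith)
  have hnn : 0 ≤ r ^ 3 / (216 * M ^ 2) := by positivity
  have he := Real.add_one_le_exp (r ^ 3 / (216 * M ^ 2))
  have hkey : M / (1728 * Real.exp (r ^ 3 / (216 * M ^ 2))) ≤ √((2 * M - r) * (M - r)) := by
    apply Real.le_sqrt_of_sq_le
    rw [div_pow, div_le_iff₀ (by positivity), mul_pow]
    generalize Real.exp (r ^ 3 / (216 * M ^ 2)) = e at he
    rcases le_total r (M / 2) with h | h
    · have h1 : M ^ 2 / 4 ≤ (2 * M - r) * (M - r) := by nlinarith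
      have h2 : 1 ≤ e ^ 2 := by nlinarith
      nlinarith [mul_le_mul h1 h2 zero_le_one hP.le, sq_nonneg M]
    · have h1 : M ≤ (2 * M - r) * (M - r) := by nlinarith
      have h3 : M / 1728 ≤ r ^ 3 / (216 * M ^ 2) := by
        rw [div_le_div_iff₀ (by norm_num) (by positivity)]
        have := pow_le_pow_left₀ (by positivity) h 3
        nlinarith
      have h2 : M / 1728 ≤ e ^ 2 := by nlinarith
      nlinarith [mul_le_mul h1 h2 (by positivity) hP.le, sq_nonneg M]
  have hL : ((2 * M - r) * (M - r)) ^ (-(1 : ℝ) / 2) = (√((2 * M - r) * (M - r)))⁻¹ := by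
    rw [Real.sqrt_eq_rpow, ← Real.rpow_neg hP.le]
    norm_num
  rw [hL]
  calc _ ≤ (M / (1728 * Real.exp (r ^ 3 / (216 * M ^ 2))))⁻¹ :=
        inv_anti₀ (by positivity) hkey
    _ = _ := by rw [inv_div]; ring
end
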